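/- arXiv:2005.11095 — 2 statements merged into one kernel-verified Lean document; each statement's English description precedes it below -/
import Mathlib

section
/- There exists an infinite subset 𝒰 of ℤ_{≤ −1} (the negative integers) such that (𝒰, 𝒱) is a co-minimal pair in (ℤ, +), where 𝒱 = {2^n : n ≥ 0} ∪ {−2^n : n ≥ 0}. -/
open scoped Pointwise

/-- Nonempty subsets `A`, `B` of an abelian group `G` form a *co-minimal pair* if
`A + B = G`, no nonempty proper subset of `A` is an additive complement of `B`,
and no nonempty proper subset of `B` is an additive complement of `A`. -/
def IsCoMinimalPair {G : Type*} [AddCommGroup G] (A B : Set G) : Prop :=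
  A.Nonempty ∧ B.Nonempty ∧ A + B = Set.univ ∧
    (∀ A' : Set G, A'.Nonempty → A' ⊂ A → A' + B ≠ Set.univ) ∧
    (∀ B' : Set G, B'.Nonempty → B' ⊂ B → A + B' ≠ Set.univ)

/-- `𝒱 = {2^n : n ≥ 0} ∪ {−2^n : n ≥ 0}`. -/
def Vset : Set ℤ := {x | ∃ n : ℕ, x = 2 ^ n ∨ x = -(2 ^ n)}

/-- The sets `U_n`: `U_0 = {−2, −1}`, `U_1 = U_2 = ∅`, `U_3 = {6} − (1 + 2^4)`,
`U_4 = {3, 4, 14} − (1 + 2^5)`, and for `n ≥ 5`,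
`U_n = ((2^(n−3) + {1, ..., 2^(n−3)}) ∪ (2^(n−1) + 2^(n−2) + {1, ..., 2^(n−4)})) − (1 + 2^(n+1))`. -/
def Useq : ℕ → Set ℤ
  | 0 => {-2, -1}
  | 1 => ∅
  | 2 => ∅
  | 3 => {6 - (1 + 2 ^ 4)}
  | 4 => (fun x => x - (1 + 2 ^ 5)) '' {3, 4, 14}
  | n + 5 => (fun x => x - (1 + 2 ^ (n + 6))) ''
      (Set.Icc ((2 : ℤ) ^ (n + 2) + 1) (2 ^ (n + 2) + 2 ^ (n + 2)) ∪
       Set.Icc ((2 : ℤ) ^ (n + 4) + 2 ^ (n + 3) + 1) (2 ^ (n + 4) + 2 ^ (n + 3) + 2 ^ (n + 1)))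

/-- `U = ⋃_{n ≥ 0} U_n`. -/
def Uset : Set ℤ := ⋃ n, Useq n

open Filter

lemma two_pow_mem_Vset (n : ℕ) : (2 : ℤ) ^ n ∈ Vset := ⟨n, Or.inl rfl⟩

lemma neg_mem_Vset {x : ℤ} (hx : x ∈ Vset) : -x ∈ Vset := by
  obtain ⟨n, rfl | rfl⟩ := hx
  exacts [⟨n, Or.inr rfl⟩, ⟨n, Or.inl (neg_neg _)⟩]

lemma eventually_lt_two_pow (c : ℤ) : ∀ᶠ n : ℕ in atTop, c < 2 ^ n := by
  filter_upwards [eventually_ge_atTop c.natAbs] with n hn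
  have h : (n : ℤ) < 2 ^ n := by exact_mod_cast Nat.lt_two_pow_self
  omega

lemma eventually_add_two_pow_notMem_Vset {d : ℤ} (hd : d ≠ 0) :
    ∀ᶠ n : ℕ in atTop, d + 2 ^ n ∉ Vset := by
  filter_upwards [eventually_lt_two_pow (2 * |d|)] with n hn
  have h₁ := neg_abs_le d
  have h₂ := le_abs_self d
  rintro ⟨m, hm | hm⟩
  · rcases lt_trichotomy m n with h | rfl | h
    · have : (2 : ℤ) ^ (m + 1) ≤ 2 ^ n := pow_le_pow_right₀ (by norm_num) h
      rw [pow_succ] at this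
      linarith
    · exact hd (by linarith)
    · have : (2 : ℤ) ^ (n + 1) ≤ 2 ^ m := pow_le_pow_right₀ (by norm_num) h
      rw [pow_succ] at this
      linarith
  · have : (0 : ℤ) < 2 ^ m := by positivity
    linarith

/-- Finitely many negative translates of `𝒱` never cover `ℤ`. -/
lemma exists_forall_sub_notMem_Vset {T : Set ℤ} (hT : T.Finite) (hneg : ∀ u ∈ T, u < 0) :
    ∃ x : ℤ, ∀ u ∈ T, x - u ∉ Vset := by
  have h : ∀ᶠ n : ℕ in atTop, ∀ u ∈ T, -u < 2 ^ n :=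
    (eventually_all_finite hT).2 fun u _ => eventually_lt_two_pow (-u)
  obtain ⟨n, hn⟩ := h.exists
  refine ⟨3 * 2 ^ n, fun u hu => ?_⟩
  have h₁ := hneg u hu
  have h₂ := hn u hu
  rintro ⟨m, hm | hm⟩
  · rcases le_or_gt m (n + 1) with h | h
    · have : (2 : ℤ) ^ m ≤ 2 ^ (n + 1) := pow_le_pow_right₀ (by norm_num) h
      rw [pow_succ] at this
      linarith
    · have : (2 : ℤ) ^ (n + 2) ≤ 2 ^ m := pow_le_pow_right₀ (by norm_num) h
      rw [pow_add] at this
      linarith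
  · have : (0 : ℤ) < 2 ^ m := by positivity
    linarith

/-- A finite approximation to a negative co-minimal partner of `𝒱`: a finite set of pairs `(u, v)`
with `u < 0` and `v ∈ 𝒱` such that `u` is the only first component from which `u + v` can be
reached by adding an element of `𝒱`. -/
def IsPrivateFamily (S : Finset (ℤ × ℤ)) : Prop :=
  (∀ p ∈ S, p.1 < 0 ∧ p.2 ∈ Vset) ∧
    ∀ p ∈ S, ∀ q ∈ S, p.1 + p.2 - q.1 ∈ Vset → q.1 = p.1

lemma IsPrivateFamily.exists_insert {S : Finset (ℤ × ℤ)} (hS : IsPrivateFamily S) {x v : ℤ}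
    (hx : ∀ p ∈ S, x - p.1 ∉ Vset) (hv : v ∈ Vset) :
    ∃ u, x - u ∈ Vset ∧ IsPrivateFamily (insert (u, v) S) := by
  have h₁ : ∀ᶠ n : ℕ in atTop, ∀ p ∈ S, (p.1 + p.2 - x) + 2 ^ n ∉ Vset := by
    refine (eventually_all_finset S).2 fun p hp => eventually_add_two_pow_notMem_Vset fun h => ?_
    refine hx p hp ?_
    rw [show x - p.1 = p.2 by linarith]
    exact (hS.1 p hp).2
  have h₂ : ∀ᶠ n : ℕ in atTop, ∀ p ∈ S, (p.1 - x - v) + 2 ^ n ∉ Vset := by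
    refine (eventually_all_finset S).2 fun p hp => eventually_add_two_pow_notMem_Vset fun h => ?_
    refine hx p hp ?_
    rw [show x - p.1 = -v by linarith]
    exact neg_mem_Vset hv
  obtain ⟨n, hn, hn₁, hn₂⟩ := ((eventually_lt_two_pow x).and (h₁.and h₂)).exists
  refine ⟨x - 2 ^ n, by simpa using two_pow_mem_Vset n, ?_, ?_⟩
  · intro p hp
    rcases Finset.mem_insert.1 hp with rfl | hp
    · exact ⟨by dsimp only; linarith, hv⟩
    · exact hS.1 p hp
  · intro p hp q hq hpq
    rcases Finset.mem_insert.1 hp with rfl | hp <;> rcases Finset.mem_insert.1 hq with rfl | hq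
    · rfl
    · refine absurd (neg_mem_Vset hpq) ?_
      convert hn₂ q hq using 2
      ring
    · refine absurd hpq ?_
      convert hn₁ p hp using 2
      ring
    · exact hS.2 p hp q hq hpq

lemma IsPrivateFamily.exists_extension {S : Finset (ℤ × ℤ)} (hS : IsPrivateFamily S) (x : ℤ)
    {v : ℤ} (hv : v ∈ Vset) :
    ∃ S', IsPrivateFamily S' ∧ S ⊆ S' ∧ (∃ p ∈ S', x - p.1 ∈ Vset) ∧ ∃ p ∈ S', p.2 = v := by
  by_cases hx : ∃ p ∈ S, x - p.1 ∈ Vset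
  · obtain ⟨y, hy⟩ := exists_forall_sub_notMem_Vset (T := Prod.fst '' (S : Set (ℤ × ℤ)))
      (S.finite_toSet.image _) (by rintro _ ⟨p, hp, rfl⟩; exact (hS.1 p hp).1)
    obtain ⟨u, -, hu⟩ := hS.exists_insert (fun p hp => hy _ ⟨p, hp, rfl⟩) hv
    obtain ⟨p, hp, hxp⟩ := hx
    exact ⟨_, hu, Finset.subset_insert _ _, ⟨p, Finset.mem_insert_of_mem hp, hxp⟩,
      (u, v), Finset.mem_insert_self _ _, rfl⟩
  · push Not at hx
    obtain ⟨u, hxu, hu⟩ := hS.exists_insert hx hv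
    exact ⟨_, hu, Finset.subset_insert _ _, ⟨(u, v), Finset.mem_insert_self _ _, hxu⟩,
      (u, v), Finset.mem_insert_self _ _, rfl⟩

/-- The limit of a generic chain of finite approximations. -/
lemma exists_generic_private_family :
    ∃ R : Set (ℤ × ℤ), (∀ p ∈ R, p.1 < 0 ∧ p.2 ∈ Vset) ∧
      (∀ p ∈ R, ∀ q ∈ R, p.1 + p.2 - q.1 ∈ Vset → q.1 = p.1) ∧
      (∀ x, ∃ p ∈ R, x - p.1 ∈ Vset) ∧ ∀ v ∈ Vset, ∃ p ∈ R, p.2 = v := by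
  let P := {S : Finset (ℤ × ℤ) // IsPrivateFamily S}
  have := Encodable.ofCountable (ℤ × Vset)
  let 𝒟 : ℤ × Vset → Order.Cofinal P := fun i =>
    { carrier := {S | (∃ p ∈ S.1, i.1 - p.1 ∈ Vset) ∧ ∃ p ∈ S.1, p.2 = i.2}
      isCofinal := fun S => by
        obtain ⟨S', hS', hle, h⟩ := S.2.exists_extension i.1 i.2.2
        exact ⟨⟨S', hS'⟩, h, hle⟩ }
  let I := Order.idealOfCofinals (⟨∅, by simp [IsPrivateFamily]⟩ : P) 𝒟
  have meets : ∀ x, ∀ v ∈ Vset, ∃ S ∈ I, (∃ p ∈ S.1, x - p.1 ∈ Vset) ∧ ∃ p ∈ S.1, p.2 = v :=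
    fun x v hv =>
      let ⟨S, hS, hSI⟩ := Order.cofinal_meets_idealOfCofinals _ 𝒟 (x, ⟨v, hv⟩)
      ⟨S, hSI, hS⟩
  refine ⟨{p | ∃ S ∈ I, p ∈ S.1}, ?_, ?_, fun x => ?_, fun v hv => ?_⟩
  · rintro p ⟨S, -, hp⟩
    exact S.2.1 p hp
  · rintro p ⟨S, hS, hp⟩ q ⟨S', hS', hq⟩
    obtain ⟨S'', -, hle, hle'⟩ := I.directed S hS S' hS'
    exact S''.2.2 p (hle hp) q (hle' hq)
  · obtain ⟨S, hS, ⟨p, hp, h⟩, -⟩ := meets x 1 (by simpa using two_pow_mem_Vset 0)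
    exact ⟨p, ⟨S, hS, hp⟩, h⟩
  · obtain ⟨S, hS, -, p, hp, h⟩ := meets 0 v hv
    exact ⟨p, ⟨S, hS, hp⟩, h⟩

/-- There exists an infinite subset `𝒰` of the negative integers such that
`(𝒰, 𝒱)` is a co-minimal pair in `ℤ`. -/
theorem exists_infinite_cominimal_with_Vset :
    ∃ 𝒰 : Set ℤ, 𝒰.Infinite ∧ (∀ u ∈ 𝒰, u ≤ -1) ∧ IsCoMinimalPair 𝒰 Vset := by
  obtain ⟨R, hR, hpriv, hcover, hV⟩ := exists_generic_private_family
  have hneg : ∀ u ∈ Prod.fst '' R, u < 0 := by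
    rintro _ ⟨p, hp, rfl⟩
    exact (hR p hp).1
  refine ⟨Prod.fst '' R, fun hfin => ?_, fun u hu => Int.le_sub_one_of_lt (hneg u hu), ?_,
    ⟨_, two_pow_mem_Vset 0⟩, ?_, ?_, ?_⟩
  · obtain ⟨x, hx⟩ := exists_forall_sub_notMem_Vset hfin hneg
    obtain ⟨p, hp, h⟩ := hcover x
    exact hx _ ⟨p, hp, rfl⟩ h
  · obtain ⟨p, hp, -⟩ := hcover 0
    exact ⟨_, p, hp, rfl⟩
  · refine Set.eq_univ_of_forall fun x => ?_
    obtain ⟨p, hp, h⟩ := hcover x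
    exact Set.mem_add.2 ⟨p.1, ⟨p, hp, rfl⟩, _, h, by ring⟩
  · rintro A - hA hsum
    obtain ⟨_, ⟨p, hp, rfl⟩, hpA⟩ := Set.exists_of_ssubset hA
    obtain ⟨a, ha, w, hw, h⟩ := Set.mem_add.1 (hsum ▸ Set.mem_univ (p.1 + p.2))
    obtain ⟨q, hq, rfl⟩ := hA.subset ha
    exact hpA (hpriv p hp q hq (by rwa [← h, add_sub_cancel_left]) ▸ ha)
  · rintro B - hB hsum
    obtain ⟨v, hv, hvB⟩ := Set.exists_of_ssubset hB
    obtain ⟨p, hp, rfl⟩ := hV v hv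
    obtain ⟨_, ⟨q, hq, rfl⟩, w, hw, h⟩ := Set.mem_add.1 (hsum ▸ Set.mem_univ (p.1 + p.2))
    have hqp := hpriv p hp q hq (by rw [← h, add_sub_cancel_left]; exact hB.subset hw)
    rw [hqp, add_right_inj] at h
    exact hvB (h ▸ hw)
end

section
/- 𝒯 is a minimal complement of S in ℤ: S + 𝒯 = ℤ, and S + 𝒯' ≠ ℤ for every nonempty proper subset 𝒯' ⊊ 𝒯. -/
open scoped Pointwise

/-- `𝒯 = {1, 2, 4, 8, ...}`, the powers of two. -/
def Tset : Set ℤ := {x | ∃ n : ℕ, x = 2 ^ n}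

/-- `J_0 = J_1 = {1}`, `J_n = {1, ..., 2^(n-2)} ∪ (2^(n-1) + J_(n-1))` for `n ≥ 2`. -/
def Jset : ℕ → Set ℤ
  | 0 => {1}
  | 1 => {1}
  | n + 2 => Set.Icc (1 : ℤ) (2 ^ n) ∪ (fun x => 2 ^ (n + 1) + x) '' Jset (n + 1)

/-- `K_0 = J_0`, `K_1 = J_1`, `K_2 = J_2 \ {1}`, and
`K_n = {2^(n-3)+1, ..., 2^(n-2)} ∪ (2^(n-1) + 2^(n-2) + J_(n-2))` for `n ≥ 3`. -/
def Kset : ℕ → Set ℤ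
  | 0 => Jset 0
  | 1 => Jset 1
  | 2 => Jset 2 \ {1}
  | n + 3 => Set.Icc ((2 : ℤ) ^ n + 1) (2 ^ (n + 1)) ∪
      (fun x => 2 ^ (n + 2) + 2 ^ (n + 1) + x) '' Jset (n + 1)

/-- `I_n = K_n − (1 + 2^(n+1))`. -/
def Iset (n : ℕ) : Set ℤ := (fun x => x - (1 + 2 ^ (n + 1))) '' Kset n

/-- `S = ⋃_{n ≥ 0} I_n`. -/
def Sset : Set ℤ := ⋃ n, Iset n

/-- Two powers of two are equal or differ by a factor of at least two. -/
theorem two_pow_trichotomy (a b : ℕ) :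
    a = b ∨ a < b ∧ (2 : ℤ) * 2 ^ a ≤ 2 ^ b ∨ b < a ∧ (2 : ℤ) * 2 ^ b ≤ 2 ^ a := by
  have key : ∀ c d : ℕ, c < d → (2 : ℤ) * 2 ^ c ≤ 2 ^ d := fun c d h => by
    rw [← pow_succ']
    exact pow_le_pow_right₀ (by norm_num) h
  rcases lt_trichotomy a b with h | h | h
  · exact Or.inr (Or.inl ⟨h, key _ _ h⟩)
  · exact Or.inl h
  · exact Or.inr (Or.inr ⟨h, key _ _ h⟩)

theorem mem_Jset_succ_iff (n : ℕ) (z : ℤ) :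
    z ∈ Jset (n + 1) ↔ z = 2 ^ (n + 1) - 1 ∨
      ∃ k : ℕ, k + 1 ≤ n ∧ 3 * 2 ^ k < 2 ^ (n + 1) + 1 - z ∧ 2 ^ (n + 1) + 1 - z ≤ 4 * 2 ^ k := by
  induction n generalizing z with
  | zero => simp [Jset]
  | succ n ih =>
    have e1 : (2 : ℤ) ^ (n + 1 + 1) = 4 * 2 ^ n := by ring
    have e2 : (2 : ℤ) ^ (n + 1) = 2 * 2 ^ n := by ring
    simp only [Jset, Set.mem_union, Set.mem_Icc, Set.mem_image]
    constructor
    · rintro (⟨h1, h2⟩ | ⟨w, hw, rfl⟩)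
      · exact Or.inr ⟨n, le_rfl, by omega, by omega⟩
      · rcases (ih w).1 hw with h | ⟨k, hk, h1, h2⟩
        · left; omega
        · exact Or.inr ⟨k, by omega, by omega, by omega⟩
    · rintro (h | ⟨k, hk, h1, h2⟩)
      · exact Or.inr ⟨z - 2 ^ (n + 1), (ih _).2 (Or.inl (by omega)), by omega⟩
      · rcases Nat.lt_or_ge k n with h | h
        · exact Or.inr ⟨z - 2 ^ (n + 1), (ih _).2 (Or.inr ⟨k, h, by omega, by omega⟩), by omega⟩
        · obtain rfl : k = n := by omega
          left; constructor <;> omega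

/-- Explicit description of `-Sset`. -/
theorem neg_mem_Sset_iff (y : ℤ) :
    -y ∈ Sset ↔ y = 2 ∨ y = 4 ∨ y = 6 ∨ (∃ p : ℕ, 14 * 2 ^ p < y ∧ y ≤ 15 * 2 ^ p) ∨
      (∃ n : ℕ, 3 ≤ n ∧ y = 2 ^ n + 2) ∨
      ∃ k n : ℕ, k + 4 ≤ n ∧ 3 * 2 ^ k < y - 2 ^ n ∧ y - 2 ^ n ≤ 4 * 2 ^ k := by
  simp only [Sset, Iset, Set.mem_iUnion, Set.mem_image]
  constructor
  · rintro ⟨n, w, hw, h⟩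
    match n, hw, h with
    | 0, hw, h => simp [Kset, Jset] at hw; left; subst hw; norm_num at h; omega
    | 1, hw, h => simp [Kset, Jset] at hw; right; left; subst hw; norm_num at h; omega
    | 2, hw, h =>
      simp [Kset, Jset] at hw
      right; right; left; norm_num at h; omega
    | n + 3, hw, h =>
      have e1 : (2 : ℤ) ^ (n + 3 + 1) = 16 * 2 ^ n := by ring
      have e2 : (2 : ℤ) ^ (n + 1) = 2 * 2 ^ n := by ring
      have e3 : (2 : ℤ) ^ (n + 2) = 4 * 2 ^ n := by ring
      have e4 : (2 : ℤ) ^ (n + 3) = 8 * 2 ^ n := by ring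
      simp only [Kset, Set.mem_union, Set.mem_Icc, Set.mem_image, mem_Jset_succ_iff] at hw
      right; right; right
      rcases hw with ⟨h1, h2⟩ | ⟨v, hv | ⟨k, hk, h1, h2⟩, rfl⟩
      · exact Or.inl ⟨n, by omega, by omega⟩
      · exact Or.inr (Or.inl ⟨n + 3, by omega, by omega⟩)
      · exact Or.inr (Or.inr ⟨k, n + 3, by omega, by omega, by omega⟩)
  · rintro (rfl | rfl | rfl | ⟨n, h1, h2⟩ | ⟨n, hn, rfl⟩ | ⟨k, n, hn, h1, h2⟩)
    · exact ⟨0, 1, by simp [Kset, Jset], by norm_num⟩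
    · exact ⟨1, 1, by simp [Kset, Jset], by norm_num⟩
    · exact ⟨2, 3, by simp [Kset, Jset], by norm_num⟩
    · have e1 : (2 : ℤ) ^ (n + 3 + 1) = 16 * 2 ^ n := by ring
      have e2 : (2 : ℤ) ^ (n + 1) = 2 * 2 ^ n := by ring
      refine ⟨n + 3, -y + (1 + 2 ^ (n + 3 + 1)), Or.inl ?_, by omega⟩
      constructor <;> omega
    all_goals
      obtain ⟨n, rfl⟩ := Nat.exists_eq_add_of_le' (show 3 ≤ n by omega)
      have e1 : (2 : ℤ) ^ (n + 3 + 1) = 16 * 2 ^ n := by ring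
      have e2 : (2 : ℤ) ^ (n + 1) = 2 * 2 ^ n := by ring
      have e3 : (2 : ℤ) ^ (n + 2) = 4 * 2 ^ n := by ring
      have e4 : (2 : ℤ) ^ (n + 3) = 8 * 2 ^ n := by ring
    · exact ⟨n + 3, 2 ^ (n + 2) + 2 ^ (n + 1) + (2 ^ (n + 1) - 1),
        Or.inr ⟨_, (mem_Jset_succ_iff _ _).2 (Or.inl rfl), rfl⟩, by omega⟩
    · exact ⟨n + 3, 2 ^ (n + 2) + 2 ^ (n + 1) + (-y + 1 + 10 * 2 ^ n),
        Or.inr ⟨_, (mem_Jset_succ_iff _ _).2 (Or.inr ⟨k, by omega, by omega, by omega⟩), rfl⟩,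
        by omega⟩

theorem exists_two_pow_le_lt (z : ℤ) (hz : 1 ≤ z) : ∃ p : ℕ, 2 ^ p ≤ z ∧ z < 2 * 2 ^ p := by
  obtain ⟨m, rfl⟩ := Int.eq_ofNat_of_zero_le (show 0 ≤ z by omega)
  refine ⟨Nat.log 2 m, ?_, ?_⟩
  · exact_mod_cast Nat.pow_log_le_self 2 (show m ≠ 0 by omega)
  · rw [← pow_succ']
    exact_mod_cast Nat.lt_pow_succ_log_self (by norm_num) m

theorem exists_two_pow_lt_le (z : ℤ) (hz : 2 ≤ z) : ∃ p : ℕ, 2 ^ p < z ∧ z ≤ 2 * 2 ^ p := by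
  obtain ⟨p, h1, h2⟩ := exists_two_pow_le_lt (z - 1) (by omega)
  exact ⟨p, by omega, by omega⟩

/-- An integer `y ≥ 3` lies in the lower or in the upper half of some `(2 ^ (k + 1), 2 ^ (k + 2)]`. -/
theorem exists_two_pow_half (y : ℤ) (hy : 3 ≤ y) :
    ∃ k : ℕ, 2 * 2 ^ k < y ∧ y ≤ 3 * 2 ^ k ∨ 3 * 2 ^ k < y ∧ y ≤ 4 * 2 ^ k := by
  obtain ⟨p, h1, h2⟩ := exists_two_pow_lt_le y (by omega)
  cases p with
  | zero => norm_num at h2; omega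
  | succ k => rw [pow_succ'] at h1 h2; exact ⟨k, by omega⟩

theorem exists_neg_add_two_pow_mem (y : ℤ) : ∃ j : ℕ, -(y + 2 ^ j) ∈ Sset := by
  simp only [neg_mem_Sset_iff]
  by_cases hneg : y < 0
  · obtain ⟨p, h1, h2⟩ := exists_two_pow_le_lt (-y) (by omega)
    have e : (2 : ℤ) ^ (p + 4) = 16 * 2 ^ p := by ring
    exact ⟨p + 4, Or.inr (Or.inr (Or.inr (Or.inl ⟨p, by omega, by omega⟩)))⟩
  by_cases h0 : y = 0
  · exact ⟨1, by left; omega⟩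
  by_cases h1 : y = 1
  · exact ⟨0, by left; omega⟩
  by_cases h2 : y = 2
  · exact ⟨1, by right; left; omega⟩
  obtain ⟨m, ⟨hl, hu⟩ | ⟨hl, hu⟩⟩ := exists_two_pow_half y (by omega)
  swap
  · exact ⟨m + 4, by right; right; right; right; right; exact ⟨m, m + 4, le_rfl, by omega, by omega⟩⟩
  have e1 : (2 : ℤ) ^ (m + 1) = 2 * 2 ^ m := by ring
  have e2 : (2 : ℤ) ^ (m + 2) = 4 * 2 ^ m := by ring
  rcases m.eq_zero_or_pos with rfl | hm
  · exact ⟨0, by right; left; norm_num at hl hu ⊢; omega⟩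
  by_cases c1 : y = 2 ^ (m + 1) + 1
  · rcases Nat.lt_or_ge m 2 with h | h
    · obtain rfl : m = 1 := by omega
      exact ⟨0, by right; right; left; omega⟩
    · exact ⟨0, by right; right; right; right; left; exact ⟨m + 1, by omega, by omega⟩⟩
  by_cases c2 : y = 2 ^ (m + 1) + 2
  · exact ⟨m + 1, by right; right; right; right; left; exact ⟨m + 2, by omega, by omega⟩⟩
  obtain ⟨k, ⟨kl, ku⟩ | ⟨kl, ku⟩⟩ := exists_two_pow_half (y - 2 ^ (m + 1)) (by omega)
  · rcases two_pow_trichotomy (k + 2) m with h | ⟨h, -⟩ | ⟨-, h⟩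
    · subst h
      have e3 : (2 : ℤ) ^ (k + 2) = 4 * 2 ^ k := by ring
      exact ⟨k + 2, by right; right; right; left; exact ⟨k, by omega, by omega⟩⟩
    · exact ⟨k, by right; right; right; right; right
                   exact ⟨k, m + 1, by omega, by omega, by omega⟩⟩
    · have e3 : (2 : ℤ) ^ (k + 2) = 4 * 2 ^ k := by ring
      omega
  · have hk : k + 2 ≤ m := by
      rcases two_pow_trichotomy (k + 1) m with h | ⟨h, -⟩ | ⟨-, h⟩
      · subst h
        have e3 : (2 : ℤ) ^ (k + 1) = 2 * 2 ^ k := by ring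
        omega
      · omega
      · have e3 : (2 : ℤ) ^ (k + 1) = 2 * 2 ^ k := by ring
        omega
    exact ⟨m + 1, by right; right; right; right; right
                     exact ⟨k, m + 2, by omega, by omega, by omega⟩⟩

theorem sixteen_mul_two_pow_le {k n : ℕ} (h : k + 4 ≤ n) : (16 : ℤ) * 2 ^ k ≤ 2 ^ n := by
  have e : (2 : ℤ) ^ (k + 4) = 16 * 2 ^ k := by ring
  have : (2 : ℤ) ^ (k + 4) ≤ 2 ^ n := pow_le_pow_right₀ (by norm_num) h
  omega

theorem eq_zero_of_neg_one_sub_mem (j : ℕ) (h : -(1 + 2 ^ j : ℤ) ∈ Sset) : j = 0 := by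
  by_contra hj
  obtain ⟨i, rfl⟩ := Nat.exists_eq_add_of_le' (Nat.one_le_iff_ne_zero.2 hj)
  have ei : (2 : ℤ) ^ (i + 1) = 2 * 2 ^ i := by ring
  rw [neg_mem_Sset_iff] at h
  rcases h with h | h | h | ⟨p, h1, h2⟩ | ⟨n, hn, h⟩ | ⟨k, n, hn, h1, h2⟩
  iterate 3 omega
  · have := pow_pos (show (0 : ℤ) < 2 by norm_num) p
    have e : (2 : ℤ) ^ (p + 3) = 8 * 2 ^ p := by ring
    rcases two_pow_trichotomy (i + 1) (p + 3) with h | ⟨-, h⟩ | ⟨-, h⟩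
    · rw [h] at h1; omega
    all_goals omega
  · obtain ⟨n, rfl⟩ := Nat.exists_eq_add_of_le' hn
    have e : (2 : ℤ) ^ (n + 3) = 8 * 2 ^ n := by ring
    omega
  · have := pow_pos (show (0 : ℤ) < 2 by norm_num) k
    have := sixteen_mul_two_pow_le hn
    rcases two_pow_trichotomy (i + 1) n with h | ⟨-, h⟩ | ⟨-, h⟩
    · rw [h] at h1; omega
    all_goals omega

theorem lt_of_two_pow_lt {a b : ℕ} (h : (2 : ℤ) ^ a < 2 ^ b) : a < b :=
  (pow_lt_pow_iff_right₀ (by norm_num)).1 h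

theorem eq_one_of_neg_thirty_seven_sub_mem (j : ℕ) (h : -(37 + 2 ^ j : ℤ) ∈ Sset) : j = 1 := by
  have hjpos := pow_pos (show (0 : ℤ) < 2 by norm_num) j
  rw [neg_mem_Sset_iff] at h
  rcases h with h | h | h | ⟨p, h1, h2⟩ | ⟨n, hn, h⟩ | ⟨k, n, hn, h1, h2⟩
  iterate 3 omega
  · have := pow_pos (show (0 : ℤ) < 2 by norm_num) p
    have e : (2 : ℤ) ^ (p + 3) = 8 * 2 ^ p := by ring
    have hle : (2 : ℤ) ^ j ≤ 8 * 2 ^ p := by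
      rcases two_pow_trichotomy j (p + 3) with h | ⟨-, h⟩ | ⟨-, h⟩
      · rw [h]; omega
      all_goals omega
    have hp : p < 3 := lt_of_two_pow_lt (by norm_num; omega)
    have hj : j < 6 := lt_of_two_pow_lt (by interval_cases p <;> norm_num <;> omega)
    interval_cases p <;> interval_cases j <;> omega
  · obtain ⟨n, rfl⟩ := Nat.exists_eq_add_of_le' hn
    have e : (2 : ℤ) ^ (n + 3) = 8 * 2 ^ n := by ring
    rcases j.eq_zero_or_pos with rfl | hj
    · omega
    · obtain ⟨j, rfl⟩ := Nat.exists_eq_add_of_le' (show 1 ≤ j from hj)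
      have e : (2 : ℤ) ^ (j + 1) = 2 * 2 ^ j := by ring
      omega
  · have hkpos := pow_pos (show (0 : ℤ) < 2 by norm_num) k
    have hkn := sixteen_mul_two_pow_le hn
    rcases two_pow_trichotomy j n with rfl | ⟨hj, h⟩ | ⟨-, h⟩
    · have hk : k < 4 := lt_of_two_pow_lt (by norm_num; omega)
      interval_cases k <;> omega
    · have hn' : n < 7 := lt_of_two_pow_lt (by norm_num; omega)
      have hk : k < 3 := by omega
      interval_cases n <;> interval_cases j <;> interval_cases k <;> omega
    · omega

theorem eq_succ_of_neg_three_mul_sub_mem (t j : ℕ) (ht : 1 ≤ t)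
    (h : -(3 * 2 ^ t + 2 ^ j : ℤ) ∈ Sset) : j = t + 1 := by
  have hjpos := pow_pos (show (0 : ℤ) < 2 by norm_num) j
  have htpos : (2 : ℤ) ^ 1 ≤ 2 ^ t := pow_le_pow_right₀ (by norm_num) ht
  rw [neg_mem_Sset_iff] at h
  rcases h with h | h | h | ⟨p, h1, h2⟩ | ⟨n, hn, h⟩ | ⟨k, n, hn, h1, h2⟩
  iterate 3 omega
  · have := pow_pos (show (0 : ℤ) < 2 by norm_num) p
    have e1 : (2 : ℤ) ^ (p + 1) = 2 * 2 ^ p := by ring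
    have e2 : (2 : ℤ) ^ (p + 2) = 4 * 2 ^ p := by ring
    have e3 : (2 : ℤ) ^ (p + 3) = 8 * 2 ^ p := by ring
    rcases two_pow_trichotomy t (p + 2) with rfl | ⟨a, ha⟩ | ⟨-, ha⟩
    · rcases two_pow_trichotomy j (p + 1) with rfl | ⟨-, h⟩ | ⟨-, h⟩ <;> omega
    · rcases two_pow_trichotomy t (p + 1) with rfl | ⟨b, hb⟩ | ⟨-, hb⟩
      · rcases two_pow_trichotomy j (p + 3) with rfl | ⟨-, h⟩ | ⟨-, h⟩ <;> omega
      · rcases two_pow_trichotomy j (p + 3) with rfl | ⟨-, h⟩ | ⟨-, h⟩ <;> omega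
      · omega
    · omega
  · rcases Nat.lt_or_ge t 2 with h' | h'
    · obtain rfl : t = 1 := by omega
      rcases two_pow_trichotomy j n with rfl | ⟨a, ha⟩ | ⟨-, ha⟩
      · omega
      · have : j < 3 := lt_of_two_pow_lt (by norm_num; omega)
        have := pow_le_pow_right₀ (show (1 : ℤ) ≤ 2 by norm_num) hn
        interval_cases j <;> omega
      · omega
    · obtain ⟨t, rfl⟩ := Nat.exists_eq_add_of_le' h'
      obtain ⟨n, rfl⟩ := Nat.exists_eq_add_of_le' hn
      have e1 : (2 : ℤ) ^ (t + 2) = 4 * 2 ^ t := by ring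
      have e2 : (2 : ℤ) ^ (n + 3) = 8 * 2 ^ n := by ring
      rcases Nat.lt_or_ge j 2 with hj | hj
      · interval_cases j
        · omega
        · rcases two_pow_trichotomy (t + 2) (n + 2) with h3 | ⟨-, h3⟩ | ⟨-, h3⟩
          · obtain rfl : t = n := by omega
            omega
          all_goals
            have e3 : (2 : ℤ) ^ (n + 2) = 4 * 2 ^ n := by ring
            omega
      · obtain ⟨j, rfl⟩ := Nat.exists_eq_add_of_le' hj
        have e3 : (2 : ℤ) ^ (j + 2) = 4 * 2 ^ j := by ring
        omega
  · have hkpos := pow_pos (show (0 : ℤ) < 2 by norm_num) k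
    have hkn := sixteen_mul_two_pow_le hn
    rcases two_pow_trichotomy j n with rfl | ⟨a, ha⟩ | ⟨-, ha⟩
    · rcases two_pow_trichotomy t k with rfl | ⟨-, h⟩ | ⟨-, h⟩ <;> omega
    · obtain ⟨m, rfl⟩ := Nat.exists_eq_add_of_le' (show 2 ≤ n by omega)
      have e1 : (2 : ℤ) ^ (m + 1) = 2 * 2 ^ m := by ring
      have e2 : (2 : ℤ) ^ (m + 2) = 4 * 2 ^ m := by ring
      rcases two_pow_trichotomy t m with rfl | ⟨-, h⟩ | ⟨-, h⟩
      · rcases two_pow_trichotomy j (t + 1) with h | ⟨-, h⟩ | ⟨-, h⟩ <;> omega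
      all_goals omega
    · omega

/-- Every power of two is the only one representing some integer as an element of `Sset + Tset`. -/
theorem exists_forall_sub_two_pow_mem_imp_eq (i : ℕ) :
    ∃ x : ℤ, ∀ j : ℕ, x - 2 ^ j ∈ Sset → j = i := by
  have key : ∀ (y : ℤ) (j : ℕ), -y - 2 ^ j = -(y + 2 ^ j) := fun y j => by ring
  match i with
  | 0 => exact ⟨-1, fun j h => eq_zero_of_neg_one_sub_mem j (key 1 j ▸ h)⟩
  | 1 => exact ⟨-37, fun j h => eq_one_of_neg_thirty_seven_sub_mem j (key 37 j ▸ h)⟩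
  | t + 2 =>
    exact ⟨-(3 * 2 ^ (t + 1)), fun j h =>
      eq_succ_of_neg_three_mul_sub_mem (t + 1) j (by omega) (key _ j ▸ h)⟩

/-- `𝒯` is a minimal complement of `S` in `ℤ`. -/
theorem Tset_minimal_complement_of_Sset :
    Sset + Tset = Set.univ ∧
      ∀ 𝒯' : Set ℤ, 𝒯'.Nonempty → 𝒯' ⊂ Tset → Sset + 𝒯' ≠ Set.univ := by
  refine ⟨Set.eq_univ_of_forall fun x => ?_, fun 𝒯' _ hss heq => ?_⟩
  · obtain ⟨j, hj⟩ := exists_neg_add_two_pow_mem (-x)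
    exact Set.mem_add.2 ⟨_, hj, 2 ^ j, ⟨j, rfl⟩, by ring⟩
  · obtain ⟨hsub, hne⟩ := hss
    obtain ⟨_, ⟨i, rfl⟩, hi⟩ := Set.not_subset.1 hne
    obtain ⟨x, hx⟩ := exists_forall_sub_two_pow_mem_imp_eq i
    obtain ⟨s, hs, u, hu, rfl⟩ := Set.mem_add.1 (heq ▸ Set.mem_univ x)
    obtain ⟨j, rfl⟩ := hsub hu
    obtain rfl := hx j (by simpa using hs)
    exact hi hu
end
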